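/- Let w be a primitive π-clustering word over A = {a_1 < ... < a_d}. Suppose π⁻¹(b) = a_1, a = a_i and b = a_{i+1} for some 1 ≤ i < d. Then the word α̃_{a,b}(w), where α̃_{a,b} sends a to ba and fixes other letters, is π'-clustering for the reordered alphabet A' = {a_i < a_1 < ... < a_{i-1} < a_{i+1} < ... < a_d} for some permutation π' of A'. -/

import Mathlib

namespace BWTpaper

variable {A : Type*}

/-- Lexicographic `≤` (as a `Bool`) on lists, induced by a strict order `lt` on letters. -/
def lexLe (lt : A → A → Bool) : List A → List A → Bool
  | [], _ => true
  | _ :: _, [] => false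
  | x :: xs, y :: ys => if lt x y then true else if lt y x then false else lexLe lt xs ys

/-- The list of all rotations (conjugates, with multiplicity) of a word. -/
def rotations (w : List A) : List (List A) := (List.range w.length).map (fun i => w.rotate i)

/-- Burrows-Wheeler transform with respect to a strict order `lt` on letters. -/
def bwtBy (lt : A → A → Bool) (w : List A) : List A :=
  ((rotations w).mergeSort (lexLe lt)).filterMap List.getLast?

def stdLt [LinearOrder A] : A → A → Bool := fun x y => decide (x < y)

/-- Burrows-Wheeler transform w.r.t. the order of a `LinearOrder` alphabet. -/
def bwt [LinearOrder A] (w : List A) : List A := bwtBy stdLt w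

def Conjugate (u v : List A) : Prop := ∃ x y : List A, u = x ++ y ∧ v = y ++ x

/-- `u^p`. -/
def wordPow (u : List A) (p : ℕ) : List A := (List.replicate p u).flatten

def Primitive (w : List A) : Prop := w ≠ [] ∧ ∀ (u : List A) (k : ℕ), w = wordPow u k → k = 1

/-- The letters of the alphabet, sorted increasingly w.r.t. `lt`. -/
noncomputable def sortedAlphabet [Fintype A] (lt : A → A → Bool) : List A :=
  Finset.univ.toList.mergeSort (fun x y => !(lt y x))

/-- `w` is `π`-clustering w.r.t. the letter order `lt`:
its BWT is `π(a₁)^{k₁} ⋯ π(a_d)^{k_d}` where `a₁ < ⋯ < a_d` and `k_i = |w|_{π(a_i)}`. -/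
def IsClusteringBy [Fintype A] [DecidableEq A] (lt : A → A → Bool) (π : Equiv.Perm A)
    (w : List A) : Prop :=
  bwtBy lt w = (sortedAlphabet lt).flatMap (fun c => List.replicate (w.count (π c)) (π c))

def IsClustering [Fintype A] [LinearOrder A] (π : Equiv.Perm A) (w : List A) : Prop :=
  IsClusteringBy stdLt π w

/-- The prefix of length `n` of the periodic infinite word `u^ω`. -/
def omegaTake (u : List A) (n : ℕ) : List A := ((List.replicate n u).flatten).take n

/-- The ω-order: `u ≤_ω v` iff `u^ω ≤ v^ω` lexicographically (decided on the first
`|u| + |v|` letters, which suffices by Fine and Wilf). -/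
def omegaLe (lt : A → A → Bool) (u v : List A) : Bool :=
  lexLe lt (omegaTake u (u.length + v.length)) (omegaTake v (u.length + v.length))

/-- Extended Burrows-Wheeler transform of a multiset (list) of words. -/
def ebwtBy (lt : A → A → Bool) (W : List (List A)) : List A :=
  ((W.flatMap rotations).mergeSort (omegaLe lt)).filterMap List.getLast?

/-- A multiset of words is `π`-clustering if its eBWT consists of the blocks
`π(a₁)^{k₁} ⋯ π(a_d)^{k_d}` with `k_i` the total number of occurrences of `π(a_i)`. -/
def IsClusteringMultisetBy [Fintype A] [DecidableEq A] (lt : A → A → Bool)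
    (π : Equiv.Perm A) (W : List (List A)) : Prop :=
  ebwtBy lt W =
    (sortedAlphabet lt).flatMap
      (fun c => List.replicate ((W.map (fun w => w.count (π c))).sum) (π c))

/-- The morphism `α_{a,b} : a ↦ ab`, `c ↦ c` for `c ≠ a`. -/
def alphaM [DecidableEq A] (a b : A) (w : List A) : List A :=
  w.flatMap (fun c => if c = a then [a, b] else [c])

/-- The morphism `α̃_{a,b} : a ↦ ba`, `c ↦ c` for `c ≠ a`. -/
def tildeM [DecidableEq A] (a b : A) (w : List A) : List A :=
  w.flatMap (fun c => if c = a then [b, a] else [c])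


/-- The rotations of `p ++ s` that start at a position of `s`. -/
def rotationsFrom (p : List A) : List A → List (List A)
  | [] => []
  | c :: s => (c :: s ++ p) :: rotationsFrom (p ++ [c]) s

theorem rotationsFrom_eq_map (p s : List A) :
    rotationsFrom p s =
      (List.range s.length).map (fun i => (p ++ s).rotate (p.length + i)) := by
  induction s generalizing p with
  | nil => simp [rotationsFrom]
  | cons c s ih =>
    rw [rotationsFrom, ih, List.length_cons, List.range_succ_eq_map, List.map_cons,
      List.map_map, Nat.add_zero, List.rotate_append_length_eq]
    refine congrArg _ (List.map_congr_left fun i _ => ?_)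
    simp [Nat.add_assoc, Nat.add_comm 1 i]

theorem rotations_eq_rotationsFrom (w : List A) : rotations w = rotationsFrom [] w := by
  simp [rotationsFrom_eq_map, rotations]

theorem perm_of_mem_rotations {u w : List A} (h : u ∈ rotations w) : u.Perm w := by
  obtain ⟨i, -, rfl⟩ := List.mem_map.1 h
  exact List.rotate_perm w i

section Lex

variable (f : A → ℕ)

theorem lexLe_total (u v : List A) :
    (lexLe (fun x y => decide (f x < f y)) u v ||
      lexLe (fun x y => decide (f x < f y)) v u) = true := by
  induction u generalizing v with
  | nil => simp [lexLe]
  | cons x u ih =>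
    cases v with
    | nil => simp [lexLe]
    | cons y v =>
      have := ih v
      rcases lt_trichotomy (f x) (f y) with h | h | h
      · simp [lexLe, h]
      · simpa [lexLe, h] using this
      · simp [lexLe, h]

theorem lexLe_trans (u v z : List A)
    (huv : lexLe (fun x y => decide (f x < f y)) u v = true)
    (hvz : lexLe (fun x y => decide (f x < f y)) v z = true) :
    lexLe (fun x y => decide (f x < f y)) u z = true := by
  induction u generalizing v z with
  | nil => simp [lexLe]
  | cons x u ih =>
    cases v with
    | nil => simp [lexLe] at huv
    | cons y v =>
      cases z with
      | nil => simp [lexLe] at hvz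
      | cons t z =>
        have := ih v z
        simp only [lexLe, decide_eq_true_eq] at *
        grind

theorem lexLe_antisymm (hf : f.Injective) (u v : List A)
    (huv : lexLe (fun x y => decide (f x < f y)) u v = true)
    (hvu : lexLe (fun x y => decide (f x < f y)) v u = true) : u = v := by
  induction u generalizing v with
  | nil =>
    cases v with
    | nil => rfl
    | cons y v => simp [lexLe] at hvu
  | cons x u ih =>
    cases v with
    | nil => simp [lexLe] at huv
    | cons y v =>
      have := ih v
      have := @hf x y
      simp only [lexLe, decide_eq_true_eq] at *
      grind

end Lex

section Tilde

variable [DecidableEq A] {a b : A}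

theorem tildeM_cons (c : A) (w : List A) :
    tildeM a b (c :: w) = (if c = a then [b, a] else [c]) ++ tildeM a b w := rfl

theorem tildeM_append (u v : List A) : tildeM a b (u ++ v) = tildeM a b u ++ tildeM a b v :=
  List.flatMap_append

theorem getLast?_tildeM (u : List A) : (tildeM a b u).getLast? = u.getLast? := by
  induction u using List.reverseRecOn with
  | nil => rfl
  | append_singleton u c _ =>
    rw [tildeM_append, tildeM_cons]
    by_cases h : c = a <;> simp [h, tildeM]

theorem count_tildeM (hab : a ≠ b) (w : List A) (x : A) :
    (tildeM a b w).count x = (if x = b then w.count a else 0) + w.count x := by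
  induction w with
  | nil => simp [tildeM]
  | cons c w ih =>
    rw [tildeM_cons, List.count_append, ih]
    simp only [List.count_cons]
    split_ifs <;> simp_all [List.count_cons] <;> grind

theorem exists_tildeM_eq_cons (hab : a ≠ b) {u : List A} (hu : u ≠ []) :
    ∃ c t, tildeM a b u = c :: t ∧ c ≠ a := by
  cases u with
  | nil => exact absurd rfl hu
  | cons c u =>
    rw [tildeM_cons]
    by_cases h : c = a
    · exact ⟨b, _, by simp [h]; rfl, hab.symm⟩
    · exact ⟨c, _, by simp [h]; rfl, h⟩

/-- The rotations of `tildeM a b w` are the images of the rotations of `w`, together with one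
rotation starting with `a` and ending with `b` for each occurrence of `a`. -/
theorem exists_rotationsFrom_tildeM_perm (p s : List A) :
    ∃ X : List (List A), (∀ x ∈ X, x.head? = some a ∧ x.getLast? = some b) ∧
      X.length = s.count a ∧
      (X ++ (rotationsFrom p s).map (tildeM a b)).Perm
        (rotationsFrom (tildeM a b p) (tildeM a b s)) := by
  induction s generalizing p with
  | nil => exact ⟨[], by simp, by simp, by simp [rotationsFrom, tildeM]⟩
  | cons c s ih =>
    obtain ⟨X, hX, hlen, hperm⟩ := ih (p ++ [c])
    rw [tildeM_append, tildeM_cons] at hperm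
    by_cases h : c = a
    · subst h
      refine ⟨(c :: tildeM c b s ++ tildeM c b p ++ [b]) :: X, ?_, by simp [hlen], ?_⟩
      · intro x hx
        rcases List.mem_cons.1 hx with rfl | hx
        · simp [List.getLast?_cons]
        · exact hX x hx
      · simp only [rotationsFrom, tildeM_cons, List.map_cons, tildeM_append, if_true,
          List.cons_append, List.nil_append, List.append_assoc] at hperm ⊢
        refine (List.Perm.cons _ List.perm_middle).trans ((List.Perm.swap _ _ _).trans ?_)
        exact (hperm.cons _).cons _
    · refine ⟨X, hX, by simp [hlen, h], ?_⟩
      simp only [rotationsFrom, tildeM_cons, List.map_cons, tildeM_append, if_neg h,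
          List.cons_append, List.nil_append] at hperm ⊢
      exact List.perm_middle.trans (hperm.cons _)

theorem lexLe_tildeM {f g : A → ℕ} (hf : f.Injective) (hab : a ≠ b)
    (hga : ∀ c, c ≠ a → g a < g c)
    (hfg : ∀ c e, c ≠ a → e ≠ a → f c < f e → g c < g e)
    (hb : ∀ c, f c < f b ↔ f c ≤ f a) {u v : List A} (hperm : u.Perm v)
    (h : lexLe (fun x y => decide (f x < f y)) u v = true) :
    lexLe (fun x y => decide (g x < g y)) (tildeM a b u) (tildeM a b v) = true := by
  induction u generalizing v with
  | nil => simp [tildeM, lexLe]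
  | cons x u ih =>
    cases v with
    | nil => simp [lexLe] at h
    | cons y v =>
      by_cases hxy : x = y
      · subst hxy
        have := ih (List.Perm.cons_inv hperm) (by simpa [lexLe] using h)
        rw [tildeM_cons, tildeM_cons]
        split_ifs <;> simpa [lexLe] using this
      have hlt : f x < f y := by
        by_contra hn
        have : f y < f x := lt_of_le_of_ne (not_lt.1 hn) fun e => hxy (hf e.symm)
        simp [lexLe, hn, this] at h
      rw [tildeM_cons, tildeM_cons]
      by_cases hx : x = a
      · subst hx
        by_cases hy : y = b
        · subst hy
          have hv : v ≠ [] := by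
            rintro rfl
            exact hxy (by simpa using hperm.subset (List.mem_cons_self))
          obtain ⟨c, t, ht, hc⟩ := exists_tildeM_eq_cons hab hv
          simp [ht, hab.symm, lexLe, hga c hc]
        · have hyx : y ≠ x := Ne.symm hxy
          have hby : f b < f y := lt_of_le_of_ne
            (not_lt.1 fun e => absurd ((hb y).1 e) (not_le.2 hlt)) fun e => hy (hf e.symm)
          simp [hyx, lexLe, hfg b y hab.symm hyx hby]
      · by_cases hy : y = a
        · subst hy
          simp [hx, lexLe, hfg x b hx hab.symm ((hb x).2 hlt.le)]
        · simp [hx, hy, lexLe, hfg x y hx hy hlt]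

theorem bwtBy_tildeM {f g : A → ℕ} (hf : f.Injective) (hg : g.Injective) (hab : a ≠ b)
    (hga : ∀ c, c ≠ a → g a < g c)
    (hfg : ∀ c e, c ≠ a → e ≠ a → f c < f e → g c < g e)
    (hb : ∀ c, f c < f b ↔ f c ≤ f a) {w : List A} (hw : w ≠ []) :
    bwtBy (fun x y => decide (g x < g y)) (tildeM a b w) =
      List.replicate (w.count a) b ++ bwtBy (fun x y => decide (f x < f y)) w := by
  obtain ⟨X, hX, hlen, hperm⟩ := exists_rotationsFrom_tildeM_perm (a := a) (b := b) [] w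
  rw [← rotations_eq_rotationsFrom, show tildeM a b [] = [] from rfl,
    ← rotations_eq_rotationsFrom] at hperm
  have hsort : (rotations (tildeM a b w)).mergeSort (lexLe (fun x y => decide (g x < g y))) =
      X.mergeSort (lexLe (fun x y => decide (g x < g y))) ++
        ((rotations w).mergeSort (lexLe (fun x y => decide (f x < f y)))).map
          (tildeM a b) := by
    refine List.Perm.eq_of_pairwise
      (le := fun u v => lexLe (fun x y => decide (g x < g y)) u v = true)
      (fun u v _ _ h₁ h₂ => lexLe_antisymm g hg u v h₁ h₂)
      (List.pairwise_mergeSort (lexLe_trans g) (lexLe_total g) _) ?_ ?_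
    · refine List.pairwise_append.2
        ⟨List.pairwise_mergeSort (lexLe_trans g) (lexLe_total g) _, ?_, ?_⟩
      · refine List.pairwise_map.2 (List.Pairwise.imp_of_mem ?_
          (List.pairwise_mergeSort (lexLe_trans f) (lexLe_total f) (rotations w)))
        intro u v hu hv h
        exact lexLe_tildeM hf hab hga hfg hb
          ((perm_of_mem_rotations (List.mem_mergeSort.1 hu)).trans
            (perm_of_mem_rotations (List.mem_mergeSort.1 hv)).symm) h
      · intro x hx y hy
        obtain ⟨u, hu, rfl⟩ := List.mem_map.1 hy
        have hu' : u ≠ [] := by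
          rintro rfl
          exact hw (perm_of_mem_rotations (List.mem_mergeSort.1 hu)).nil_eq.symm
        obtain ⟨c, t, ht, hc⟩ := exists_tildeM_eq_cons hab hu'
        obtain ⟨s, rfl⟩ := List.head?_eq_some_iff.1 (hX x (List.mem_mergeSort.1 hx)).1
        simp [ht, lexLe, hga c hc]
    · exact (List.mergeSort_perm _ _).trans (hperm.symm.trans
        ((List.mergeSort_perm _ _).symm.append ((List.mergeSort_perm _ _).symm.map _)))
  have hlast : (X.mergeSort (lexLe (fun x y => decide (g x < g y)))).filterMap List.getLast? =
      List.replicate (w.count a) b := by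
    rw [← hlen, ← (List.mergeSort_perm X (lexLe (fun x y => decide (g x < g y)))).length_eq,
      ← List.map_const', ← List.filterMap_eq_map]
    exact List.filterMap_congr fun x hx => (hX x (List.mem_mergeSort.1 hx)).2
  rw [bwtBy, hsort, List.filterMap_append, hlast, List.filterMap_map, bwtBy]
  congr 2
  exact funext getLast?_tildeM

end Tilde

theorem sortedAlphabet_perm [Fintype A] (lt : A → A → Bool) :
    (sortedAlphabet lt).Perm Finset.univ.toList :=
  List.mergeSort_perm _ _

theorem nodup_sortedAlphabet [Fintype A] (lt : A → A → Bool) : (sortedAlphabet lt).Nodup :=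
  (sortedAlphabet_perm lt).nodup_iff.2 (Finset.nodup_toList _)

theorem mem_sortedAlphabet [Fintype A] (lt : A → A → Bool) (x : A) : x ∈ sortedAlphabet lt :=
  (sortedAlphabet_perm lt).mem_iff.2 (by simp)

theorem exists_perm_map_sortedAlphabet [Fintype A] [DecidableEq A] (lt lt' : A → A → Bool) :
    ∃ σ : Equiv.Perm A, (sortedAlphabet lt').map σ = sortedAlphabet lt := by
  have hlen : (sortedAlphabet lt').length = (sortedAlphabet lt).length :=
    ((sortedAlphabet_perm lt').trans (sortedAlphabet_perm lt).symm).length_eq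
  refine ⟨((nodup_sortedAlphabet lt').getEquivOfForallMemList _
      (mem_sortedAlphabet lt')).symm.trans ((finCongr hlen).trans
    ((nodup_sortedAlphabet lt).getEquivOfForallMemList _ (mem_sortedAlphabet lt))), ?_⟩
  refine List.ext_getElem (by simpa using hlen) fun i h₁ h₂ => ?_
  simp [List.Nodup.getEquivOfForallMemList, (nodup_sortedAlphabet lt').idxOf_getElem]

theorem exists_sortedAlphabet_stdLt_eq_cons [Fintype A] [LinearOrder A] {m : A}
    (hm : ∀ x, m ≤ x) : ∃ L, sortedAlphabet (stdLt (A := A)) = m :: L := by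
  have hpw : (sortedAlphabet (stdLt (A := A))).Pairwise
      (fun x y => (!(stdLt y x)) = true) := by
    refine List.pairwise_mergeSort ?_ ?_ _
    · intro x y z
      simp only [stdLt, Bool.not_eq_true', decide_eq_false_iff_not, not_lt]
      exact le_trans
    · intro x y
      simpa [stdLt] using le_total x y
  have hmem := mem_sortedAlphabet (stdLt (A := A)) m
  cases hL : sortedAlphabet (stdLt (A := A)) with
  | nil => simp [hL] at hmem
  | cons c L =>
    rw [hL] at hpw hmem
    rcases List.mem_cons.1 hmem with rfl | h
    · exact ⟨L, rfl⟩
    · have := (List.pairwise_cons.1 hpw).1 m h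
      simp only [stdLt, Bool.not_eq_true', decide_eq_false_iff_not, not_lt] at this
      exact ⟨L, by rw [le_antisymm this (hm c)]⟩

/-- Lemma (case 4): if `w` is primitive and `π`-clustering over `A = {a₁ < ⋯ < a_d}`,
`π⁻¹(b) = a₁`, `a = a_i` and `b = a_{i+1}` with `1 ≤ i < d`, then `α̃_{a,b}(w)` is
`π'`-clustering for the reordered alphabet `A' = {a_i < a₁ < ⋯ < a_{i-1} < a_{i+1} < ⋯ < a_d}`
(where `a` becomes the smallest letter and the others keep their relative order),
for some permutation `π'`. -/
theorem clustering_tilde_reorder (d : ℕ) (π : Equiv.Perm (Fin d)) (a b : Fin d)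
    (hab : a ≠ b) (w : List (Fin d)) (hprim : Primitive w) (hcl : IsClustering π w)
    (hb1 : ((π.symm b : Fin d) : ℕ) = 0)
    (hsucc : (b : ℕ) = (a : ℕ) + 1) :
    ∃ π' : Equiv.Perm (Fin d),
      IsClusteringBy
        (fun x y => if x = a then decide (y ≠ a) else (decide (y ≠ a) && decide (x < y)))
        π' (tildeM a b w) := by
  set lt' : Fin d → Fin d → Bool :=
    fun x y => if x = a then decide (y ≠ a) else (decide (y ≠ a) && decide (x < y)) with hlt'
  let g : Fin d → ℕ := fun x => if x = a then 0 else (x : ℕ) + 1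
  have hg : lt' = fun x y => decide (g x < g y) := by
    funext x y
    by_cases hx : x = a <;> by_cases hy : y = a <;> simp [hlt', g, hx, hy]
  have hginj : g.Injective := by
    intro x y h
    simp only [g] at h
    split_ifs at h with hx hy hy
    · rw [hx, hy]
    · omega
  have hbwt : bwtBy lt' (tildeM a b w) = List.replicate (w.count a) b ++ bwtBy stdLt w := by
    rw [hg]
    refine bwtBy_tildeM (f := fun x : Fin d => (x : ℕ)) Fin.val_injective hginj hab ?_ ?_ ?_
      hprim.1
    · intro c hc
      simp [g, hc]
    · intro c e hc he h
      simpa [g, hc, he] using h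
    · intro c
      omega
  obtain ⟨σ, hσ⟩ := exists_perm_map_sortedAlphabet stdLt lt'
  obtain ⟨L, hL⟩ := exists_sortedAlphabet_stdLt_eq_cons (m := π.symm b)
    fun x => Fin.le_def.2 (hb1 ▸ Nat.zero_le _)
  have hnd := nodup_sortedAlphabet (stdLt (A := Fin d))
  refine ⟨σ.trans π, ?_⟩
  unfold IsClustering IsClusteringBy at *
  have hmap := List.flatMap_map (f := σ) (l := sortedAlphabet lt')
    (g := fun c => List.replicate ((tildeM a b w).count (π c)) (π c))
  simp only [Equiv.trans_apply]
  rw [hbwt, hcl, ← hmap, hσ, hL]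
  rw [hL, List.nodup_cons] at hnd
  simp only [List.flatMap_cons, Equiv.apply_symm_apply, count_tildeM hab, if_true,
    List.replicate_add, List.append_assoc]
  refine congrArg _ (congrArg _ (List.flatMap_congr fun c hc => ?_))
  have hcb : π c ≠ b := by
    rintro rfl
    exact hnd.1 (by simpa using hc)
  simp [hcb]

end BWTpaper
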